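/- For all κ, H > 0 and all ε > 0, if λ(ε, H) < κ², then E_gs(κ, H, ε) < 0; consequently every pair (ψ, A′) attaining the ground-state energy has ψ not identically zero on Ω_ε (every minimizer of the Ginzburg–Landau functional is non-trivial). -/

import Mathlib

open MeasureTheory Real Set

noncomputable section

/-- The thin tubular neighbourhood `Ω_ε = {x ∈ Ω : dist(x, ∂Ω) < ε}`. -/
def OmegaEps (Ω : Set (ℝ × ℝ)) (ε : ℝ) : Set (ℝ × ℝ) :=
  {x | x ∈ Ω ∧ Metric.infDist x (frontier Ω) < ε}

/-- `M` is a `C²`, `2L`-periodic, unit-speed parameterization of `∂Ω`,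
injective on a period. -/
def BoundaryParam (Ω : Set (ℝ × ℝ)) (L : ℝ) (M : ℝ → ℝ × ℝ) : Prop :=
  ContDiff ℝ 2 M ∧ Function.Periodic M (2 * L) ∧
  (∀ s : ℝ, (deriv M s).1 ^ 2 + (deriv M s).2 ^ 2 = 1) ∧
  Set.InjOn M (Set.Ico 0 (2 * L)) ∧ Set.range M = frontier Ω

/-- The scalar curl `∂₁A₂ − ∂₂A₁` of a planar vector field. -/
def curl2 (A : ℝ × ℝ → ℝ × ℝ) (x : ℝ × ℝ) : ℝ :=
  fderiv ℝ (fun y => (A y).2) x (1, 0) - fderiv ℝ (fun y => (A y).1) x (0, 1)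

/-- `f` is `C¹` on an open neighbourhood of the closure of `S`. -/
def C1Nhd {E : Type*} [NormedAddCommGroup E] [NormedSpace ℝ E]
    (f : ℝ × ℝ → E) (S : Set (ℝ × ℝ)) : Prop :=
  ∃ U : Set (ℝ × ℝ), IsOpen U ∧ closure S ⊆ U ∧ ContDiffOn ℝ 1 f U

/-- The pointwise squared magnetic gradient `|(∇ − i b A)u|²`. -/
def mgNormSq (b : ℝ) (A : ℝ × ℝ → ℝ × ℝ) (u : ℝ × ℝ → ℂ) (x : ℝ × ℝ) : ℝ :=
  ‖fderiv ℝ u x (1, 0) - Complex.I * (b : ℂ) * ((A x).1 : ℂ) * u x‖ ^ 2 +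
  ‖fderiv ℝ u x (0, 1) - Complex.I * (b : ℂ) * ((A x).2 : ℂ) * u x‖ ^ 2

/-- The lowest magnetic Neumann eigenvalue of `−(∇ − i b A)²` on `Ω_ε`,
characterized variationally as the infimum of Rayleigh quotients. -/
def lam (Ω : Set (ℝ × ℝ)) (A : ℝ × ℝ → ℝ × ℝ) (ε b : ℝ) : ℝ :=
  sInf { r : ℝ | ∃ u : ℝ × ℝ → ℂ, C1Nhd u (OmegaEps Ω ε) ∧
    (0 < ∫ x in OmegaEps Ω ε, ‖u x‖ ^ 2) ∧
    r = (∫ x in OmegaEps Ω ε, mgNormSq b A u x) /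
        (∫ x in OmegaEps Ω ε, ‖u x‖ ^ 2) }

/-- The circulation `γ₀ = |Ω| / |∂Ω|` with `|∂Ω| = 2L`. -/
def gamma0 (Ω : Set (ℝ × ℝ)) (L : ℝ) : ℝ := (volume Ω).toReal / (2 * L)

/-- `i₀(c, a, ε) = inf_{n ∈ ℤ} |n + (L/π)(γ₀(a/ε + c) + a/2)|`. -/
def i0 (L γ₀ c a ε : ℝ) : ℝ :=
  ⨅ n : ℤ, |(n : ℝ) + (L / π) * (γ₀ * (a / ε + c) + a / 2)|

/-- `e₀(c, a, ε) = a²/12 + (π i₀/L)²`. -/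
def e0 (L γ₀ c a ε : ℝ) : ℝ :=
  a ^ 2 / 12 + (π * i0 L γ₀ c a ε / L) ^ 2

/-- The Ginzburg–Landau energy of the pair `(ψ, A')`. -/
def GLenergy (Ω : Set (ℝ × ℝ)) (κ H ε : ℝ) (ψ : ℝ × ℝ → ℂ)
    (A' : ℝ × ℝ → ℝ × ℝ) : ℝ :=
  (∫ x in OmegaEps Ω ε,
      (mgNormSq H A' ψ x - κ ^ 2 * ‖ψ x‖ ^ 2 + κ ^ 2 / 2 * ‖ψ x‖ ^ 4)) +
  H ^ 2 * ∫ x in Ω, (curl2 A' x - 1) ^ 2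

/-- Admissible Ginzburg–Landau configurations. -/
def GLadm (Ω : Set (ℝ × ℝ)) (ε : ℝ) (ψ : ℝ × ℝ → ℂ)
    (A' : ℝ × ℝ → ℝ × ℝ) : Prop :=
  C1Nhd ψ (OmegaEps Ω ε) ∧ C1Nhd A' Ω

/-- The Ginzburg–Landau ground-state energy. -/
def Egs (Ω : Set (ℝ × ℝ)) (κ H ε : ℝ) : ℝ :=
  sInf { E : ℝ | ∃ ψ A', GLadm Ω ε ψ A' ∧ E = GLenergy Ω κ H ε ψ A' }


theorem omegaEps_isOpen (Ω : Set (ℝ × ℝ)) (hΩo : IsOpen Ω) (ε : ℝ) : IsOpen (OmegaEps Ω ε) :=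
  hΩo.inter (isOpen_lt (Metric.continuous_infDist_pt _) continuous_const)

theorem omegaEps_subset (Ω : Set (ℝ × ℝ)) (ε : ℝ) : OmegaEps Ω ε ⊆ Ω := fun _ h => h.1

theorem omegaEps_nonempty (Ω : Set (ℝ × ℝ)) (hne : (frontier Ω).Nonempty) (ε : ℝ) (hε : 0 < ε) :
    (OmegaEps Ω ε).Nonempty := by
  obtain ⟨p, hp⟩ := hne
  obtain ⟨q, hq, hd⟩ := Metric.mem_closure_iff.1 (frontier_subset_closure hp) ε hε
  exact ⟨q, hq, lt_of_le_of_lt (Metric.infDist_le_dist_of_mem hp) (by rwa [dist_comm])⟩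

theorem mgNormSq_nonneg (b : ℝ) (A : ℝ × ℝ → ℝ × ℝ) (u : ℝ × ℝ → ℂ) (x : ℝ × ℝ) :
    0 ≤ mgNormSq b A u x := by unfold mgNormSq; positivity

theorem integrableOn_of_closure {S : Set (ℝ × ℝ)} (hb : Bornology.IsBounded S) {f : ℝ × ℝ → ℝ}
    (hf : ContinuousOn f (closure S)) : IntegrableOn f S :=
  (hf.integrableOn_compact hb.isCompact_closure).mono_set subset_closure

theorem mgNormSq_integrable {S T : Set (ℝ × ℝ)} (hST : S ⊆ T) (hb : Bornology.IsBounded S)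
    (b : ℝ) (A : ℝ × ℝ → ℝ × ℝ) (u : ℝ × ℝ → ℂ) (hA : C1Nhd A T) (hu : C1Nhd u S) :
    IntegrableOn (mgNormSq b A u) S := by
  apply integrableOn_of_closure hb
  obtain ⟨U, hU, hSU, hcu⟩ := hu
  obtain ⟨V, hV, hTV, hcA⟩ := hA
  have h1 : ContinuousOn (fderiv ℝ u) (closure S) :=
    (hcu.continuousOn_fderiv_of_isOpen hU le_rfl).mono hSU
  have h2 : ContinuousOn u (closure S) := hcu.continuousOn.mono hSU
  have h3 : ContinuousOn A (closure S) := hcA.continuousOn.mono ((closure_mono hST).trans hTV)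
  have h4 : ContinuousOn (fun x => ((A x).1 : ℂ)) (closure S) :=
    Complex.continuous_ofReal.comp_continuousOn (continuous_fst.comp_continuousOn h3)
  have h5 : ContinuousOn (fun x => ((A x).2 : ℂ)) (closure S) :=
    Complex.continuous_ofReal.comp_continuousOn (continuous_snd.comp_continuousOn h3)
  have h6 : ∀ v : ℝ × ℝ, ContinuousOn (fun x => fderiv ℝ u x v) (closure S) :=
    fun v => h1.clm_apply continuousOn_const
  unfold mgNormSq
  exact ((((h6 _).sub ((continuousOn_const.mul h4).mul h2)).norm).pow 2).add
    ((((h6 _).sub ((continuousOn_const.mul h5).mul h2)).norm).pow 2)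

theorem mgNormSq_smul (b t : ℝ) (A : ℝ × ℝ → ℝ × ℝ) (u : ℝ × ℝ → ℂ) (x : ℝ × ℝ)
    (hu : DifferentiableAt ℝ u x) :
    mgNormSq b A (fun y => t • u y) x = t ^ 2 * mgNormSq b A u x := by
  unfold mgNormSq
  have h : fderiv ℝ (fun y => t • u y) x = t • fderiv ℝ u x := fderiv_fun_const_smul hu t
  have key : ∀ (z w c : ℂ), ‖t • z - c * (t • w)‖ ^ 2 = t ^ 2 * ‖z - c * w‖ ^ 2 := by
    intro z w c
    have : t • z - c * (t • w) = t • (z - c * w) := by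
      simp only [Complex.real_smul]; ring
    rw [this, norm_smul, mul_pow, Real.norm_eq_abs, sq_abs]
  rw [h]
  simp only [_root_.smul_apply]
  rw [key, key]; ring

theorem GLenergy_lower (Ω : Set (ℝ × ℝ)) (hb : Bornology.IsBounded Ω)
    (κ H ε : ℝ) (ψ : ℝ × ℝ → ℂ) (A' : ℝ × ℝ → ℝ × ℝ) :
    -(∫ _x in OmegaEps Ω ε, κ ^ 2 / 2) ≤ GLenergy Ω κ H ε ψ A' := by
  unfold GLenergy
  have h2 : 0 ≤ H ^ 2 * ∫ x in Ω, (curl2 A' x - 1) ^ 2 :=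
    mul_nonneg (sq_nonneg _) (integral_nonneg fun x => sq_nonneg _)
  have hc : IntegrableOn (fun _ : ℝ × ℝ => κ ^ 2 / 2) (OmegaEps Ω ε) :=
    integrableOn_of_closure (hb.subset (omegaEps_subset Ω ε)) continuousOn_const
  have h0 : 0 ≤ ∫ _x in OmegaEps Ω ε, κ ^ 2 / 2 := integral_nonneg fun x => by positivity
  have h1 : -(∫ _x in OmegaEps Ω ε, κ ^ 2 / 2) ≤ ∫ x in OmegaEps Ω ε,
      (mgNormSq H A' ψ x - κ ^ 2 * ‖ψ x‖ ^ 2 + κ ^ 2 / 2 * ‖ψ x‖ ^ 4) := by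
    by_cases hi : IntegrableOn (fun x => mgNormSq H A' ψ x - κ ^ 2 * ‖ψ x‖ ^ 2
        + κ ^ 2 / 2 * ‖ψ x‖ ^ 4) (OmegaEps Ω ε)
    · rw [← integral_neg]
      refine integral_mono hc.neg hi fun x => ?_
      have := mgNormSq_nonneg H A' ψ x
      have h3 : 0 ≤ κ ^ 2 / 2 * (‖ψ x‖ ^ 2 - 1) ^ 2 := by positivity
      simp only
      nlinarith
    · rw [integral_undef hi]; linarith
  linarith

theorem GLenergy_zero (Ω : Set (ℝ × ℝ)) (ho : IsOpen Ω)
    (κ H ε : ℝ) (ψ : ℝ × ℝ → ℂ) (A' : ℝ × ℝ → ℝ × ℝ)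
    (h : ∀ x ∈ OmegaEps Ω ε, ψ x = 0) : 0 ≤ GLenergy Ω κ H ε ψ A' := by
  unfold GLenergy
  have h2 : 0 ≤ H ^ 2 * ∫ x in Ω, (curl2 A' x - 1) ^ 2 :=
    mul_nonneg (sq_nonneg _) (integral_nonneg fun x => sq_nonneg _)
  have h1 : 0 ≤ ∫ x in OmegaEps Ω ε,
      (mgNormSq H A' ψ x - κ ^ 2 * ‖ψ x‖ ^ 2 + κ ^ 2 / 2 * ‖ψ x‖ ^ 4) := by
    refine setIntegral_nonneg (omegaEps_isOpen Ω ho ε).measurableSet fun x hx => ?_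
    have := mgNormSq_nonneg H A' ψ x
    rw [h x hx]; simpa using this
  linarith

/-- If `λ(ε, H) < κ²` then the ground-state energy is negative and every
minimizer of the Ginzburg–Landau functional is non-trivial. -/
theorem stmt_7 (Ω : Set (ℝ × ℝ)) (hΩo : IsOpen Ω) (hΩb : Bornology.IsBounded Ω)
    (hΩsc : SimplyConnectedSpace ↥Ω)
    (L : ℝ) (hL : 0 < L) (M : ℝ → ℝ × ℝ) (hM : BoundaryParam Ω L M)
    (A : ℝ × ℝ → ℝ × ℝ) (hA : C1Nhd A Ω) (hcurl : ∀ x ∈ Ω, curl2 A x = 1) :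
    ∀ κ > (0 : ℝ), ∀ H > (0 : ℝ), ∀ ε > (0 : ℝ),
      lam Ω A ε H < κ ^ 2 →
      Egs Ω κ H ε < 0 ∧
      (∀ ψ : ℝ × ℝ → ℂ, ∀ A' : ℝ × ℝ → ℝ × ℝ, GLadm Ω ε ψ A' →
        GLenergy Ω κ H ε ψ A' = Egs Ω κ H ε →
        ∃ x ∈ OmegaEps Ω ε, ψ x ≠ 0) := by
  intro κ hκ H hH ε hε hlam
  have hO := omegaEps_isOpen Ω hΩo ε
  have hOb : Bornology.IsBounded (OmegaEps Ω ε) := hΩb.subset (omegaEps_subset Ω ε)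
  have hfne : (frontier Ω).Nonempty := by
    rw [← hM.2.2.2.2]; exact range_nonempty M
  have hOne := omegaEps_nonempty Ω hfne ε hε
  have hneg : Egs Ω κ H ε < 0 := by
    obtain ⟨r, ⟨u, hu, hpos, rfl⟩, hr⟩ := exists_lt_of_csInf_lt (by
      refine ⟨_, fun _ => 1, ⟨univ, isOpen_univ, subset_univ _, contDiffOn_const⟩, ?_, rfl⟩
      have hv : 0 < volume (OmegaEps Ω ε) := hO.measure_pos volume hOne
      have hv' : volume (OmegaEps Ω ε) ≠ ⊤ := hOb.measure_lt_top.ne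
      simp only [norm_one, one_pow, integral_const, smul_eq_mul, mul_one]
      simpa [Measure.real] using ENNReal.toReal_pos hv.ne' hv') hlam
    rw [div_lt_iff₀ hpos] at hr
    have hmg := mgNormSq_integrable (omegaEps_subset Ω ε) hOb H A u hA hu
    obtain ⟨U, hU, hSU, hcu⟩ := hu
    have hcont : ContinuousOn u (closure (OmegaEps Ω ε)) := hcu.continuousOn.mono hSU
    have hi2 : IntegrableOn (fun x => ‖u x‖ ^ 2) (OmegaEps Ω ε) :=
      integrableOn_of_closure hOb (hcont.norm.pow 2)
    have hi4 : IntegrableOn (fun x => ‖u x‖ ^ 4) (OmegaEps Ω ε) :=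
      integrableOn_of_closure hOb (hcont.norm.pow 4)
    have hE : ∀ t : ℝ, GLenergy Ω κ H ε (fun y => t • u y) A =
        t ^ 2 * ((∫ x in OmegaEps Ω ε, mgNormSq H A u x)
          - κ ^ 2 * ∫ x in OmegaEps Ω ε, ‖u x‖ ^ 2)
        + t ^ 4 * (κ ^ 2 / 2 * ∫ x in OmegaEps Ω ε, ‖u x‖ ^ 4) := by
      intro t
      unfold GLenergy
      have hz : ∫ x in Ω, (curl2 A x - 1) ^ 2 = 0 := by
        rw [setIntegral_congr_fun (g := fun _ => (0 : ℝ)) hΩo.measurableSet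
          (fun x hx => by simp [hcurl x hx])]
        simp
      rw [hz, mul_zero, add_zero]
      rw [setIntegral_congr_fun (g := fun x => t ^ 2 * (mgNormSq H A u x - κ ^ 2 * ‖u x‖ ^ 2)
        + t ^ 4 * (κ ^ 2 / 2 * ‖u x‖ ^ 4)) hO.measurableSet]
      · have hs : IntegrableOn (fun x => t ^ 2 * (mgNormSq H A u x - κ ^ 2 * ‖u x‖ ^ 2))
            (OmegaEps Ω ε) := (hmg.sub (hi2.const_mul _)).const_mul _
        rw [integral_add hs
          ((hi4.const_mul _).const_mul _), integral_const_mul, integral_const_mul,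
          integral_sub hmg (hi2.const_mul _), integral_const_mul, integral_const_mul]
      · intro x hx
        have hd : DifferentiableAt ℝ u x :=
          (hcu.differentiableOn one_ne_zero).differentiableAt
            (hU.mem_nhds (hSU (subset_closure hx)))
        have h2 : ‖t • u x‖ ^ 2 = t ^ 2 * ‖u x‖ ^ 2 := by
          rw [norm_smul, mul_pow, Real.norm_eq_abs, sq_abs]
        have h4 : ‖t • u x‖ ^ 4 = t ^ 4 * ‖u x‖ ^ 4 := by
          calc ‖t • u x‖ ^ 4 = (‖t • u x‖ ^ 2) ^ 2 := by ring
            _ = _ := by rw [h2]; ring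
        simp only
        rw [mgNormSq_smul H t A u x hd, h2, h4]; ring
    set a := (∫ x in OmegaEps Ω ε, mgNormSq H A u x)
          - κ ^ 2 * ∫ x in OmegaEps Ω ε, ‖u x‖ ^ 2 with ha
    set c := κ ^ 2 / 2 * ∫ x in OmegaEps Ω ε, ‖u x‖ ^ 4 with hc
    have ha0 : a < 0 := by linarith
    have hc0 : 0 ≤ c := mul_nonneg (by positivity) (integral_nonneg fun x => by positivity)
    have hq : 0 < -a / (2 * (c + 1)) := by
      apply div_pos <;> linarith
    set t := √(-a / (2 * (c + 1))) with ht
    have ht2 : t ^ 2 = -a / (2 * (c + 1)) := Real.sq_sqrt hq.le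
    have hlt : GLenergy Ω κ H ε (fun y => t • u y) A < 0 := by
      rw [hE t]
      have h3 : t ^ 2 * (2 * (c + 1)) = -a := by
        rw [ht2]; field_simp
      have h4 : 0 < t ^ 2 := ht2 ▸ hq
      have h5 : t ^ 2 * a + t ^ 4 * c = t ^ 2 * (a + t ^ 2 * c) := by ring
      rw [h5]
      apply mul_neg_of_pos_of_neg h4
      nlinarith
    refine lt_of_le_of_lt (csInf_le ?_ ⟨fun y => t • u y, A, ⟨⟨U, hU, hSU, ?_⟩, hA⟩, rfl⟩) hlt
    · refine ⟨-(∫ _x in OmegaEps Ω ε, κ ^ 2 / 2), ?_⟩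
      rintro E ⟨ψ, A', -, rfl⟩
      exact GLenergy_lower Ω hΩb κ H ε ψ A'
    · exact hcu.const_smul t
  refine ⟨hneg, fun ψ A' _ hEq => ?_⟩
  by_contra hcon
  push Not at hcon
  have := GLenergy_zero Ω hΩo κ H ε ψ A' hcon
  linarith
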